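/- Let n ≥ 1, s ≥ 1, and s₁, s₂ > 0 with 1 ≤ s₁ < n/2 + 1 and s₁ + s₂ = s + n/2 + 1. There exists a constant c > 0 (depending only on n, s, s₁, s₂ and φ) such that for all Schwartz vector fields u, B : ℝⁿ → ℝⁿ, Σ_{i∈ℤ} ‖Λ^s[(Δ_i u·∇)(Ṡ_{i−9}B)] − (Δ_i u·∇)(Λ^s Ṡ_{i−9}B)‖²_{L²} ≤ c·‖u‖²_{Ḣ^{s₂}}·‖B‖²_{Ḣ^{s₁}}. -/

import Mathlib

open MeasureTheory Filter SchwartzMap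
open scoped FourierTransform

noncomputable section

abbrev Ell (n : ℕ) := EuclideanSpace ℝ (Fin n)

def eVec (n : ℕ) (i : Fin n) : Ell n := EuclideanSpace.single i 1

/-- coercion of a real-valued function to a complex-valued one -/
def cf {n : ℕ} (f : Ell n → ℝ) : Ell n → ℂ := fun x => (f x : ℂ)

/-- the Fourier multiplier operator `Λ^s` with symbol `|ξ|^s` -/
def Lam {n : ℕ} (s : ℝ) (f : Ell n → ℂ) : Ell n → ℂ :=
  𝓕⁻ (fun ξ => ((‖ξ‖ ^ s : ℝ) : ℂ) * 𝓕 f ξ)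

/-- the partial derivative `∂ᵢ` -/
def pd {n : ℕ} (i : Fin n) (f : Ell n → ℂ) : Ell n → ℂ :=
  fun x => fderiv ℝ f x (eVec n i)

/-- the advection term `(v·∇)w` for complex vector fields -/
def adv {n : ℕ} (v w : Fin n → Ell n → ℂ) : Fin n → Ell n → ℂ :=
  fun l x => ∑ i, v i x * pd i (w l) x

/-- squared homogeneous Sobolev norm of a complex scalar function -/
def HsqC {n : ℕ} (s : ℝ) (f : Ell n → ℂ) : ℝ :=
  ∫ ξ, ‖ξ‖ ^ (2 * s) * ‖𝓕 f ξ‖ ^ 2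

/-- homogeneous Sobolev norm `‖u‖_{Ḣ^s}` of a real vector field -/
def Hnorm {n : ℕ} (s : ℝ) (u : Fin n → Ell n → ℝ) : ℝ :=
  Real.sqrt (∑ l, HsqC s (cf (u l)))

/-- `L²` norm of a complex vector field -/
def vL2 {n : ℕ} (f : Fin n → Ell n → ℂ) : ℝ :=
  Real.sqrt (∑ l, ∫ x, ‖f l x‖ ^ 2)

/-- `L²` pairing `⟨f,g⟩ = Σ_l ∫ f_l g_l` of complex vector fields -/
def Cinner {n : ℕ} (f g : Fin n → Ell n → ℂ) : ℂ :=
  ∑ l, ∫ x, f l x * g l x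

/-- The standing assumptions on the Littlewood–Paley function `φ`: a smooth,
radial, compactly supported function with values in `[0,1]`, supported in the
annulus `{3/4 ≤ |ξ| ≤ 8/3}`, with `Σ_{j∈ℤ} φ(2^{−j}ξ) = 1` for `ξ ≠ 0` and
`φ(2^{−j}·), φ(2^{−j'}·)` having disjoint supports when `|j−j'| ≥ 2`. -/
def LPFunction {n : ℕ} (φ : Ell n → ℝ) : Prop :=
  ContDiff ℝ (⊤ : ℕ∞) φ ∧ HasCompactSupport φ ∧
  (∀ ξ, φ ξ ≠ 0 → 3 / 4 ≤ ‖ξ‖ ∧ ‖ξ‖ ≤ 8 / 3) ∧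
  (∀ ξ, φ ξ ∈ Set.Icc (0 : ℝ) 1) ∧
  (∀ ξ η : Ell n, ‖ξ‖ = ‖η‖ → φ ξ = φ η) ∧
  (∀ ξ : Ell n, ξ ≠ 0 → (∑' j : ℤ, φ ((2 : ℝ) ^ (-j) • ξ)) = 1) ∧
  (∀ j j' : ℤ, 2 ≤ |j - j'| → ∀ ξ : Ell n,
    φ ((2 : ℝ) ^ (-j) • ξ) * φ ((2 : ℝ) ^ (-j') • ξ) = 0)

/-- the homogeneous dyadic block `Δ_j u = 𝓕⁻¹(φ(2^{−j}ξ) û(ξ))` -/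
def DeltaJ {n : ℕ} (φ : Ell n → ℝ) (j : ℤ) (f : Ell n → ℂ) : Ell n → ℂ :=
  𝓕⁻ (fun ξ => ((φ ((2 : ℝ) ^ (-j) • ξ) : ℝ) : ℂ) * 𝓕 f ξ)

/-- the homogeneous cutoff `Ṡ_j u = Σ_{j' ≤ j−1} Δ_{j'} u` -/
def SJ {n : ℕ} (φ : Ell n → ℝ) (j : ℤ) (f : Ell n → ℂ) : Ell n → ℂ :=
  fun x => ∑' j' : ℤ, if j' ≤ j - 1 then DeltaJ φ j' f x else 0

/-- `L²` norm of `Δ_j u` for a real vector field `u` -/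
def DeltaL2 {n : ℕ} (φ : Ell n → ℝ) (j : ℤ) (u : Fin n → Ell n → ℝ) : ℝ :=
  Real.sqrt (∑ l, ∫ x, ‖DeltaJ φ j (cf (u l)) x‖ ^ 2)

/-- the homogeneous Besov norm `‖u‖_{Ḃ^s_{2,1}} = Σ_{j∈ℤ} 2^{js} ‖Δ_j u‖_{L²}` -/
def Bnorm {n : ℕ} (φ : Ell n → ℝ) (s : ℝ) (u : Fin n → Ell n → ℝ) : ℝ :=
  ∑' j : ℤ, (2 : ℝ) ^ ((j : ℝ) * s) * DeltaL2 φ j u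

/-! ### The low-frequency cutoff -/

/-- The smooth representative of the symbol `Σ_{j < 0} φ(2^{-j}ξ)` of `Ṡ_0`. -/
def lowCut {n : ℕ} (φ : Ell n → ℝ) (ξ : Ell n) : ℝ :=
  if ‖ξ‖ < 3 / 2 then 1 - φ ξ else 0

theorem LPFunction.eq_zero_of_lt {n : ℕ} {φ : Ell n → ℝ} (hφ : LPFunction φ) {ξ : Ell n}
    (h : ‖ξ‖ < 3 / 4) : φ ξ = 0 := by
  by_contra h0
  linarith [(hφ.2.2.1 ξ h0).1]

theorem LPFunction.eq_zero_of_gt {n : ℕ} {φ : Ell n → ℝ} (hφ : LPFunction φ) {ξ : Ell n}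
    (h : 8 / 3 < ‖ξ‖) : φ ξ = 0 := by
  by_contra h0
  linarith [(hφ.2.2.1 ξ h0).2]

theorem LPFunction.hasSum {n : ℕ} {φ : Ell n → ℝ} (hφ : LPFunction φ) {ξ : Ell n} (hξ : ξ ≠ 0) :
    HasSum (fun j : ℤ => φ ((2 : ℝ) ^ (-j) • ξ)) 1 := by
  have h := hφ.2.2.2.2.2.1 ξ hξ
  have hs : Summable fun j : ℤ => φ ((2 : ℝ) ^ (-j) • ξ) := by
    by_contra hns
    rw [tsum_eq_zero_of_not_summable hns] at h
    exact zero_ne_one h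
  rw [← h]
  exact hs.hasSum

theorem norm_two_zpow_smul {n : ℕ} (j : ℤ) (ξ : Ell n) :
    ‖(2 : ℝ) ^ j • ξ‖ = (2 : ℝ) ^ j * ‖ξ‖ := by
  rw [norm_smul, Real.norm_of_nonneg (by positivity)]

theorem LPFunction.hasSum_lowCut {n : ℕ} {φ : Ell n → ℝ} (hφ : LPFunction φ) (j : ℤ)
    {ξ : Ell n} (hξ : ξ ≠ 0) :
    HasSum (fun j' : ℤ => if j' ≤ j - 1 then φ ((2 : ℝ) ^ (-j') • ξ) else 0)
      (lowCut φ ((2 : ℝ) ^ (-j) • ξ)) := by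
  have hpos : 0 < ‖ξ‖ := norm_pos_iff.2 hξ
  have hmono : ∀ {a b : ℤ}, a ≤ b → (2 : ℝ) ^ a * ‖ξ‖ ≤ (2 : ℝ) ^ b * ‖ξ‖ := fun h => by
    gcongr
    norm_num
  unfold lowCut
  split_ifs with h
  · have h1 := (hφ.hasSum hξ).sub (hasSum_ite_eq j (φ ((2 : ℝ) ^ (-j) • ξ)))
    convert! h1 using 1
    funext j'
    rcases lt_trichotomy j' j with hj | rfl | hj
    · rw [if_pos (by omega), if_neg hj.ne, sub_zero]
    · rw [if_neg (by omega), if_pos rfl, sub_self]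
    · rw [if_neg (by omega), if_neg hj.ne', sub_zero]
      refine (hφ.eq_zero_of_lt ?_).symm
      rw [norm_two_zpow_smul] at h ⊢
      have := hmono (show -j' + 1 ≤ -j by omega)
      rw [zpow_add_one₀ two_ne_zero] at this
      linarith
  · have h0 : (fun j' : ℤ => if j' ≤ j - 1 then φ ((2 : ℝ) ^ (-j') • ξ) else 0) = 0 := by
      funext j'
      simp only [Pi.zero_apply, ite_eq_right_iff]
      intro hj
      apply hφ.eq_zero_of_gt
      rw [norm_two_zpow_smul] at h ⊢
      have := hmono (show -j + 1 ≤ -j' by omega)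
      rw [zpow_add_one₀ two_ne_zero] at this
      linarith
    rw [h0]
    exact hasSum_zero

theorem LPFunction.lowCut_eq_zero {n : ℕ} {φ : Ell n → ℝ} (hφ : LPFunction φ) {ξ : Ell n}
    (h : 4 / 3 < ‖ξ‖) : lowCut φ ξ = 0 := by
  have hξ : ξ ≠ 0 := fun h0 => by
    rw [h0, norm_zero] at h
    norm_num at h
  have h1 := hφ.hasSum_lowCut 0 hξ
  rw [neg_zero, zpow_zero, one_smul] at h1
  refine h1.unique ?_
  have h0 : (fun j' : ℤ => if j' ≤ 0 - 1 then φ ((2 : ℝ) ^ (-j') • ξ) else 0) = 0 := by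
    funext j'
    simp only [Pi.zero_apply, ite_eq_right_iff]
    intro hj
    apply hφ.eq_zero_of_gt
    rw [norm_two_zpow_smul]
    have : (2 : ℝ) ^ (1 : ℤ) ≤ (2 : ℝ) ^ (-j') := zpow_le_zpow_right₀ (by norm_num) (by omega)
    rw [zpow_one] at this
    nlinarith
  rw [h0]
  exact hasSum_zero

theorem LPFunction.contDiff_lowCut {n : ℕ} {φ : Ell n → ℝ} (hφ : LPFunction φ) :
    ContDiff ℝ (⊤ : ℕ∞) (lowCut φ) := by
  rw [contDiff_iff_contDiffAt]
  intro ξ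
  by_cases h : ‖ξ‖ < 3 / 2
  · have : lowCut φ =ᶠ[nhds ξ] fun η => 1 - φ η := by
      filter_upwards [continuous_norm.continuousAt.eventually_lt continuousAt_const h] with η hη
      simp [lowCut, hη]
    exact (contDiffAt_const.sub hφ.1.contDiffAt).congr_of_eventuallyEq this
  · have h' : 4 / 3 < ‖ξ‖ := by linarith
    have : lowCut φ =ᶠ[nhds ξ] fun _ => 0 := by
      filter_upwards [continuousAt_const.eventually_lt continuous_norm.continuousAt h'] with η hη
      exact hφ.lowCut_eq_zero hη
    exact contDiffAt_const.congr_of_eventuallyEq this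

theorem LPFunction.lowCut_mem_Icc {n : ℕ} {φ : Ell n → ℝ} (hφ : LPFunction φ) (ξ : Ell n) :
    lowCut φ ξ ∈ Set.Icc (0 : ℝ) 1 := by
  have h := hφ.2.2.2.1 ξ
  unfold lowCut
  split_ifs
  · exact ⟨by linarith [h.2], by linarith [h.1]⟩
  · simp

/-! ### Schwartz representatives -/

/-- Complexification of a real Schwartz function. -/
def toComplex {n : ℕ} (f : 𝓢(Ell n, ℝ)) : 𝓢(Ell n, ℂ) :=
  f.postcompCLM Complex.ofRealCLM

theorem coe_toComplex {n : ℕ} (f : 𝓢(Ell n, ℝ)) : ⇑(toComplex f) = cf f := rfl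

theorem exists_schwartz_mul {n : ℕ} {m : Ell n → ℝ} (hm : ContDiff ℝ (⊤ : ℕ∞) m)
    (hc : HasCompactSupport m) (f : 𝓢(Ell n, ℂ)) :
    ∃ g : 𝓢(Ell n, ℂ), ∀ ξ, g ξ = (m ξ : ℂ) * f ξ :=
  ⟨HasCompactSupport.toSchwartzMap (f := fun ξ => (m ξ : ℂ) * f ξ)
    ((hc.comp_left (g := ((↑) : ℝ → ℂ)) Complex.ofReal_zero).mul_right)
    ((Complex.ofRealCLM.contDiff.comp hm).mul (f.smooth _)), fun _ => rfl⟩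

theorem hasCompactSupport_of_norm_le {n : ℕ} {F : Type*} [Zero F] {m : Ell n → F} {R : ℝ}
    (h : ∀ ξ, R < ‖ξ‖ → m ξ = 0) : HasCompactSupport m :=
  HasCompactSupport.intro (isCompact_closedBall (0 : Ell n) R) fun ξ hξ =>
    h ξ (by simpa using hξ)

theorem exists_schwartz_dilate_mul {n : ℕ} {m : Ell n → ℝ} (hm : ContDiff ℝ (⊤ : ℕ∞) m)
    (hc : HasCompactSupport m) (j : ℤ) (f : 𝓢(Ell n, ℂ)) :
    ∃ g : 𝓢(Ell n, ℂ), ∀ ξ, g ξ = (m ((2 : ℝ) ^ (-j) • ξ) : ℂ) * f ξ :=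
  exists_schwartz_mul (m := fun ξ => m ((2 : ℝ) ^ (-j) • ξ))
    (hm.comp (contDiff_const_smul ((2 : ℝ) ^ (-j))))
    (hc.comp_smul (zpow_ne_zero _ two_ne_zero)) f

/-- `Δ_j f` is the inverse Fourier transform of its Schwartz symbol. -/
theorem deltaJ_eq {n : ℕ} {φ : Ell n → ℝ} (j : ℤ) (f : 𝓢(Ell n, ℝ)) {a : 𝓢(Ell n, ℂ)}
    (ha : ∀ ξ, a ξ = (φ ((2 : ℝ) ^ (-j) • ξ) : ℂ) * 𝓕 (toComplex f) ξ) :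
    DeltaJ φ j (cf f) = ⇑(𝓕⁻ a : 𝓢(Ell n, ℂ)) := by
  rw [fourierInv_coe, DeltaJ]
  congr 1
  funext ξ
  rw [ha, fourier_coe, coe_toComplex]

/-- `Ṡ_j f` is the inverse Fourier transform of its Schwartz symbol. -/
theorem sJ_eq {n : ℕ} (hn : 1 ≤ n) {φ : Ell n → ℝ} (hφ : LPFunction φ) (j : ℤ)
    (f : 𝓢(Ell n, ℝ)) {b : 𝓢(Ell n, ℂ)}
    (hb : ∀ ξ, b ξ = (lowCut φ ((2 : ℝ) ^ (-j) • ξ) : ℂ) * 𝓕 (toComplex f) ξ) :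
    SJ φ j (cf f) = ⇑(𝓕⁻ b : 𝓢(Ell n, ℂ)) := by
  have : NeZero n := ⟨by omega⟩
  have hne : ∀ᵐ ξ : Ell n, ξ ≠ 0 := by
    simp [ae_iff]
  have hφc : Continuous φ := hφ.1.continuous
  set F := 𝓕 (toComplex f) with hF
  funext x
  rw [fourierInv_coe, Real.fourierInv_eq]
  have key : HasSum (fun j' : ℤ => ∫ ξ, Real.fourierChar (inner ℝ ξ x) •
      (((if j' ≤ j - 1 then φ ((2 : ℝ) ^ (-j') • ξ) else 0 : ℝ) : ℂ) * F ξ))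
      (∫ ξ, Real.fourierChar (inner ℝ ξ x) • b ξ) := by
    refine hasSum_integral_of_dominated_convergence
      (fun j' ξ => φ ((2 : ℝ) ^ (-j') • ξ) * ‖F ξ‖) ?_ ?_ ?_ ?_ ?_
    · intro j'
      apply Continuous.aestronglyMeasurable
      have := F.continuous
      split_ifs <;> fun_prop
    · intro j'
      refine ae_of_all _ fun ξ => ?_
      have h0 := (hφ.2.2.2.1 ((2 : ℝ) ^ (-j') • ξ)).1
      rw [Circle.norm_smul, norm_mul, Complex.norm_real]
      gcongr
      split_ifs
      · rw [Real.norm_of_nonneg h0]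
      · simpa using h0
    · filter_upwards [hne] with ξ hξ using (hφ.hasSum hξ).summable.mul_right _
    · refine F.integrable.norm.congr ?_
      filter_upwards [hne] with ξ hξ
      rw [tsum_mul_right, (hφ.hasSum hξ).tsum_eq, one_mul]
    · filter_upwards [hne] with ξ hξ
      have h1 := (hφ.hasSum_lowCut j hξ)
      rw [hb]
      have h2 := (Complex.hasSum_ofReal.2 h1).mul_right (F ξ)
      exact h2.const_smul _
  rw [← key.tsum_eq, SJ]
  congr 1
  funext j'
  split_ifs with h
  · rw [DeltaJ, Real.fourierInv_eq, hF, fourier_coe, coe_toComplex]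
  · simp

/-! ### Estimates -/

theorem integrable_norm_sq {n : ℕ} (f : 𝓢(Ell n, ℂ)) : Integrable fun x => ‖f x‖ ^ 2 :=
  (f.memLp 2).integrable_norm_pow two_ne_zero

theorem integral_norm_sq_fourierInv {n : ℕ} (f : 𝓢(Ell n, ℂ)) :
    ∫ x, ‖(𝓕⁻ f : 𝓢(Ell n, ℂ)) x‖ ^ 2 = ∫ ξ, ‖f ξ‖ ^ 2 := by
  rw [← integral_norm_sq_fourier, FourierTransform.fourier_fourierInv_eq]

theorem norm_eVec {n : ℕ} (k : Fin n) : ‖eVec n k‖ = 1 := by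
  simp [eVec]

theorem norm_pd_fourierInv_le {n : ℕ} {g : Ell n → ℂ} (hg : Integrable g)
    (hg' : Integrable fun ξ => ‖ξ‖ * ‖g ξ‖) (k : Fin n) (x : Ell n) :
    ‖pd k (𝓕⁻ g) x‖ ≤ 2 * Real.pi * ∫ ξ, ‖ξ‖ * ‖g ξ‖ := by
  have hd : HasFDerivAt (𝓕⁻ g)
      ((𝓕 (VectorFourier.fourierSMulRight (innerSL ℝ) g) (-x)).comp
        (-ContinuousLinearMap.id ℝ (Ell n))) x := by
    have h1 := (Real.hasFDerivAt_fourier hg hg' (-x)).comp x (hasFDerivAt_id x).neg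
    refine h1.congr_of_eventuallyEq (Eventually.of_forall fun y => ?_)
    exact Real.fourierInv_eq_fourier_neg g y
  rw [pd, hd.fderiv]
  calc _ ≤ ‖𝓕 (VectorFourier.fourierSMulRight (innerSL ℝ) g) (-x)‖ := by
        refine (ContinuousLinearMap.le_opNorm _ _).trans ?_
        simp [norm_eVec]
    _ ≤ ∫ ξ, ‖VectorFourier.fourierSMulRight (innerSL ℝ) g ξ‖ :=
        VectorFourier.norm_fourierIntegral_le_integral_norm _ _ _ _ _
    _ = _ := by
        rw [← integral_const_mul]
        congr 1
        funext ξ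
        rw [VectorFourier.norm_fourierSMulRight, innerSL_apply_norm, mul_assoc]

theorem fourier_pairing_fourierInv {n : ℕ} (a b : 𝓢(Ell n, ℂ)) :
    𝓕 (pairing (ContinuousLinearMap.mul ℂ ℂ) (𝓕⁻ a : 𝓢(Ell n, ℂ)) (𝓕⁻ b : 𝓢(Ell n, ℂ))) =
      convolution (ContinuousLinearMap.mul ℂ ℂ) a b := by
  have h : pairing (ContinuousLinearMap.mul ℂ ℂ) (𝓕⁻ a : 𝓢(Ell n, ℂ)) (𝓕⁻ b : 𝓢(Ell n, ℂ)) =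
      𝓕⁻ (convolution (ContinuousLinearMap.mul ℂ ℂ) a b) := by
    ext x
    rw [fourierInv_apply_eq (convolution _ a b), fourier_convolution]
    simp [fourierInv_apply_eq, pairing_apply_apply]
  rw [h, FourierTransform.fourier_fourierInv_eq]

theorem exists_ne_zero_of_fourier_pairing_ne_zero {n : ℕ} {a b : 𝓢(Ell n, ℂ)} {ξ : Ell n}
    (h : 𝓕 (pairing (ContinuousLinearMap.mul ℂ ℂ) (𝓕⁻ a : 𝓢(Ell n, ℂ))
      (𝓕⁻ b : 𝓢(Ell n, ℂ))) ξ ≠ 0) : ∃ η, a η ≠ 0 ∧ b (ξ - η) ≠ 0 := by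
  by_contra! hc
  apply h
  rw [fourier_pairing_fourierInv, convolution_apply]
  refine integral_eq_zero_of_ae (ae_of_all _ fun η => ?_)
  by_cases hη : a η = 0
  · simp [hη]
  · simp [hc η hη]

/-- The Schwartz function `Σ_k (𝓕⁻¹a_k) ∂_k (𝓕⁻¹b)`. -/
def advSchwartz {n : ℕ} (a : Fin n → 𝓢(Ell n, ℂ)) (b : 𝓢(Ell n, ℂ)) : 𝓢(Ell n, ℂ) :=
  ∑ k, pairing (ContinuousLinearMap.mul ℂ ℂ) (𝓕⁻ (a k) : 𝓢(Ell n, ℂ))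
    (LineDeriv.lineDerivOp (eVec n k) (𝓕⁻ b : 𝓢(Ell n, ℂ)))

theorem advSchwartz_apply {n : ℕ} (a : Fin n → 𝓢(Ell n, ℂ)) (b : 𝓢(Ell n, ℂ)) (x : Ell n) :
    advSchwartz a b x = ∑ k, (𝓕⁻ (a k) : 𝓢(Ell n, ℂ)) x * pd k (𝓕⁻ b : 𝓢(Ell n, ℂ)) x := by
  simp [advSchwartz, sum_apply, pairing_apply_apply, lineDerivOp_apply_eq_fderiv, pd]

theorem exists_ne_zero_of_fourier_advSchwartz_ne_zero {n : ℕ} {a : Fin n → 𝓢(Ell n, ℂ)}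
    {b : 𝓢(Ell n, ℂ)} {ξ : Ell n} (h : 𝓕 (advSchwartz a b) ξ ≠ 0) :
    ∃ k η, a k η ≠ 0 ∧ b (ξ - η) ≠ 0 := by
  rw [advSchwartz, ← fourierTransformCLM_apply (𝕜 := ℂ), map_sum, sum_apply] at h
  obtain ⟨k, -, hk⟩ := Finset.exists_ne_zero_of_sum_ne_zero h
  rw [fourierTransformCLM_apply, lineDerivOp_fourierInv_eq] at hk
  obtain ⟨η, h1, h2⟩ := exists_ne_zero_of_fourier_pairing_ne_zero hk
  refine ⟨k, η, h1, fun h0 => h2 ?_⟩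
  rw [smul_apply, smulLeftCLM_apply_apply (by fun_prop), h0, smul_zero, smul_zero]

/-- `Λ^s` of a Schwartz function with spectrum in an annulus. -/
theorem lam_sq_integral_le {n : ℕ} {s : ℝ} (hs : 0 ≤ s) (P : 𝓢(Ell n, ℂ)) {r R : ℝ} (hr : 0 < r)
    (hP : ∀ ξ, 𝓕 P ξ ≠ 0 → r ≤ ‖ξ‖ ∧ ‖ξ‖ ≤ R) :
    (Integrable fun x => ‖Lam s P x‖ ^ 2) ∧
      ∫ x, ‖Lam s P x‖ ^ 2 ≤ (R ^ s) ^ 2 * ∫ x, ‖P x‖ ^ 2 := by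
  have hsm : ContDiff ℝ (⊤ : ℕ∞) fun ξ => ((‖ξ‖ ^ s : ℝ) : ℂ) * 𝓕 P ξ := by
    rw [contDiff_iff_contDiffAt]
    intro ξ
    by_cases h : ‖ξ‖ < r
    · have : (fun ξ => ((‖ξ‖ ^ s : ℝ) : ℂ) * 𝓕 P ξ) =ᶠ[nhds ξ] fun _ => 0 := by
        filter_upwards [continuous_norm.continuousAt.eventually_lt continuousAt_const h] with η hη
        have : 𝓕 P η = 0 := by
          by_contra h0
          linarith [(hP η h0).1]
        rw [this, mul_zero]
      exact contDiffAt_const.congr_of_eventuallyEq this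
    · have hξ : ξ ≠ 0 := fun h0 => h (by simpa [h0] using hr)
      refine ContDiffAt.mul ?_ ((𝓕 P).smooth _).contDiffAt
      exact Complex.ofRealCLM.contDiff.contDiffAt.comp ξ
        ((contDiffAt_norm ℝ hξ).rpow_const_of_ne (norm_ne_zero_iff.2 hξ))
  have hcs : HasCompactSupport fun ξ => ((‖ξ‖ ^ s : ℝ) : ℂ) * 𝓕 P ξ :=
    hasCompactSupport_of_norm_le (R := R) fun ξ hξ => by
      have : 𝓕 P ξ = 0 := by
        by_contra h0
        linarith [(hP ξ h0).2]
      rw [this, mul_zero]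
  set G : 𝓢(Ell n, ℂ) := hcs.toSchwartzMap hsm with hG
  have hL : Lam s P = ⇑(𝓕⁻ G : 𝓢(Ell n, ℂ)) := by
    rw [fourierInv_coe]
    rfl
  rw [hL]
  refine ⟨integrable_norm_sq _, ?_⟩
  rw [integral_norm_sq_fourierInv, ← integral_norm_sq_fourier P, ← integral_const_mul]
  refine integral_mono (integrable_norm_sq _) ((integrable_norm_sq _).const_mul _) fun ξ => ?_
  change ‖((‖ξ‖ ^ s : ℝ) : ℂ) * 𝓕 P ξ‖ ^ 2 ≤ _
  rw [norm_mul, mul_pow, Complex.norm_real, Real.norm_of_nonneg (by positivity)]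
  by_cases h0 : 𝓕 P ξ = 0
  · simp [h0]
  · have := (hP ξ h0).2
    gcongr

/-- Cauchy–Schwarz bound of `Σ_k v_k g_k` when all `g_k` are bounded by `K`. -/
theorem norm_sum_mul_sq_le {n : ℕ} {v g : Fin n → ℂ} {K : ℝ} (hg : ∀ k, ‖g k‖ ≤ K) :
    ‖∑ k, v k * g k‖ ^ 2 ≤ n * K ^ 2 * ∑ k, ‖v k‖ ^ 2 := by
  calc ‖∑ k, v k * g k‖ ^ 2 ≤ (∑ k, ‖v k‖ * K) ^ 2 := by
        gcongr
        refine (norm_sum_le _ _).trans (Finset.sum_le_sum fun k _ => ?_)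
        rw [norm_mul]
        gcongr
        exact hg k
    _ ≤ n * ∑ k, (‖v k‖ * K) ^ 2 := by
        simpa using sq_sum_le_card_mul_sum_sq (s := Finset.univ) (f := fun k => ‖v k‖ * K)
    _ = _ := by
        simp_rw [mul_pow]
        rw [← Finset.sum_mul]
        ring

/-- The commutator of `Λ^s` with `v·∇`, where `v` has spectrum in an annulus of size `r` and the
argument has spectrum in a much smaller ball. -/
theorem commutator_sq_integral_le {n : ℕ} {s : ℝ} (hs : 0 ≤ s) (a : Fin n → 𝓢(Ell n, ℂ))
    (b : 𝓢(Ell n, ℂ)) {r : ℝ} (hr : 0 < r)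
    (ha : ∀ k ξ, a k ξ ≠ 0 → 3 / 4 * r ≤ ‖ξ‖ ∧ ‖ξ‖ ≤ 8 / 3 * r)
    (hb : ∀ ξ, b ξ ≠ 0 → ‖ξ‖ ≤ r / 4) :
    ∫ x, ‖Lam s (fun x => ∑ k, (𝓕⁻ (a k) : 𝓢(Ell n, ℂ)) x * pd k (𝓕⁻ b : 𝓢(Ell n, ℂ)) x) x
        - ∑ k, (𝓕⁻ (a k) : 𝓢(Ell n, ℂ)) x * pd k (Lam s (𝓕⁻ b : 𝓢(Ell n, ℂ))) x‖ ^ 2 ≤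
      2 * ((4 ^ s) ^ 2 + 1) * (n * (2 * Real.pi) ^ 2) * (r ^ s) ^ 2 * (∫ ξ, ‖ξ‖ * ‖b ξ‖) ^ 2 *
        ∑ k, ∫ ξ, ‖a k ξ‖ ^ 2 := by
  set M := ∫ ξ, ‖ξ‖ * ‖b ξ‖ with hM
  have hbm : Integrable fun ξ => ‖ξ‖ * ‖b ξ‖ := by
    simpa using b.integrable_pow_mul volume 1
  set P := advSchwartz a b with hPdef
  have hPx : (fun x => ∑ k, (𝓕⁻ (a k) : 𝓢(Ell n, ℂ)) x * pd k (𝓕⁻ b : 𝓢(Ell n, ℂ)) x) = ⇑P :=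
    funext fun x => (advSchwartz_apply a b x).symm
  have hvint : ∀ K : ℝ, Integrable fun x =>
      n * K ^ 2 * ∑ k, ‖(𝓕⁻ (a k) : 𝓢(Ell n, ℂ)) x‖ ^ 2 := fun K =>
    (integrable_finsetSum _ fun k _ => integrable_norm_sq _).const_mul _
  have hvint' : ∀ K : ℝ, ∫ x, n * K ^ 2 * ∑ k, ‖(𝓕⁻ (a k) : 𝓢(Ell n, ℂ)) x‖ ^ 2 =
      n * K ^ 2 * ∑ k, ∫ ξ, ‖a k ξ‖ ^ 2 := fun K => by
    rw [integral_const_mul, integral_finsetSum _ fun k _ => integrable_norm_sq _]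
    simp_rw [integral_norm_sq_fourierInv]
  have hPint : ∫ x, ‖P x‖ ^ 2 ≤ n * (2 * Real.pi * M) ^ 2 * ∑ k, ∫ ξ, ‖a k ξ‖ ^ 2 := by
    rw [← hvint']
    refine integral_mono (integrable_norm_sq _) (hvint _) fun x => ?_
    dsimp only
    rw [advSchwartz_apply]
    refine norm_sum_mul_sq_le fun k => ?_
    rw [fourierInv_coe]
    exact norm_pd_fourierInv_le b.integrable hbm k x
  obtain ⟨hL1, hL2⟩ := lam_sq_integral_le hs P (r := r / 2) (R := 4 * r) (by positivity) (by
    intro ξ hξ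
    obtain ⟨k, η, h1, h2⟩ := exists_ne_zero_of_fourier_advSchwartz_ne_zero hξ
    have h3 := ha k η h1
    have h4 := hb _ h2
    have h5 := norm_sub_norm_le η ξ
    have h6 := norm_sub_norm_le ξ η
    rw [norm_sub_rev] at h5
    constructor <;> linarith [h3.1, h3.2])
  set g : Ell n → ℂ := fun ξ => ((‖ξ‖ ^ s : ℝ) : ℂ) * b ξ with hg
  have hLb : Lam s (𝓕⁻ b : 𝓢(Ell n, ℂ)) = 𝓕⁻ g := by
    rw [Lam, ← fourier_coe, FourierTransform.fourier_fourierInv_eq]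
  have hgc : Continuous g := by
    have h1 := b.continuous
    have h2 : Continuous fun ξ : Ell n => ‖ξ‖ ^ s := continuous_norm.rpow_const fun _ => .inr hs
    fun_prop
  have hgle : ∀ ξ, ‖g ξ‖ ≤ r ^ s * ‖b ξ‖ := fun ξ => by
    rw [hg, norm_mul, Complex.norm_real, Real.norm_of_nonneg (by positivity)]
    by_cases h0 : b ξ = 0
    · simp [h0]
    · have : ‖ξ‖ ≤ r := (hb ξ h0).trans (by linarith)
      gcongr
  have hgint : Integrable g :=
    (b.integrable.norm.const_mul (r ^ s)).mono' hgc.aestronglyMeasurable (ae_of_all _ hgle)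
  have hgle' : ∀ ξ, ‖ξ‖ * ‖g ξ‖ ≤ r ^ s * (‖ξ‖ * ‖b ξ‖) := fun ξ => by
    have := mul_le_mul_of_nonneg_left (hgle ξ) (norm_nonneg ξ)
    linarith
  have hgint' : Integrable fun ξ => ‖ξ‖ * ‖g ξ‖ :=
    (hbm.const_mul (r ^ s)).mono' (by fun_prop) (ae_of_all _ fun ξ => by
      rw [Real.norm_of_nonneg (by positivity)]
      exact hgle' ξ)
  have hMg : ∫ ξ, ‖ξ‖ * ‖g ξ‖ ≤ r ^ s * M := by
    rw [hM, ← integral_const_mul]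
    exact integral_mono hgint' (hbm.const_mul _) hgle'
  rw [hPx]
  calc _ ≤ ∫ x, (2 * ‖Lam s P x‖ ^ 2 + 2 * (n * (2 * Real.pi * (r ^ s * M)) ^ 2 *
          ∑ k, ‖(𝓕⁻ (a k) : 𝓢(Ell n, ℂ)) x‖ ^ 2)) := by
        refine integral_mono_of_nonneg (ae_of_all _ fun x => by positivity)
          ((hL1.const_mul 2).add ((hvint _).const_mul 2)) (ae_of_all _ fun x => ?_)
        have h1 : ‖∑ k, (𝓕⁻ (a k) : 𝓢(Ell n, ℂ)) x * pd k (Lam s (𝓕⁻ b : 𝓢(Ell n, ℂ))) x‖ ^ 2 ≤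
            n * (2 * Real.pi * (r ^ s * M)) ^ 2 * ∑ k, ‖(𝓕⁻ (a k) : 𝓢(Ell n, ℂ)) x‖ ^ 2 := by
          refine norm_sum_mul_sq_le fun k => ?_
          rw [hLb]
          refine (norm_pd_fourierInv_le hgint hgint' k x).trans ?_
          gcongr
        dsimp only
        refine (pow_le_pow_left₀ (norm_nonneg _) (norm_sub_le _ _) 2).trans ?_
        refine add_sq_le.trans ?_
        linarith
    _ = 2 * (∫ x, ‖Lam s P x‖ ^ 2) + 2 * (n * (2 * Real.pi * (r ^ s * M)) ^ 2 *
          ∑ k, ∫ ξ, ‖a k ξ‖ ^ 2) := by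
        rw [integral_add (hL1.const_mul 2) ((hvint _).const_mul 2), integral_const_mul,
          integral_const_mul, hvint']
    _ ≤ 2 * (((4 * r) ^ s) ^ 2 * (n * (2 * Real.pi * M) ^ 2 * ∑ k, ∫ ξ, ‖a k ξ‖ ^ 2)) +
          2 * (n * (2 * Real.pi * (r ^ s * M)) ^ 2 * ∑ k, ∫ ξ, ‖a k ξ‖ ^ 2) := by
        gcongr
        exact hL2.trans (by gcongr)
    _ = _ := by
        rw [Real.mul_rpow (by norm_num) hr.le]
        ring

theorem integrableOn_ball_norm_rpow {n : ℕ} (hn : 1 ≤ n) {p : ℝ} (hp : -(n : ℝ) < p) (r : ℝ) :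
    IntegrableOn (fun ξ : Ell n => ‖ξ‖ ^ p) (Metric.ball 0 r) := by
  have : NeZero n := ⟨by omega⟩
  rw [integrableOn_fun_norm_addHaar volume (f := fun y : ℝ => y ^ p)]
  rcases le_or_gt r 0 with hr | hr
  · simp [Set.Ioo_eq_empty_of_le hr]
  have h : IntegrableOn (fun y : ℝ => y ^ ((n : ℝ) - 1 + p)) (Set.Ioo 0 r) :=
    (intervalIntegral.integrableOn_Ioo_rpow_iff hr).2 (by linarith)
  refine h.congr_fun (fun y hy => ?_) measurableSet_Ioo
  dsimp only
  rw [smul_eq_mul, finrank_euclideanSpace_fin, Real.rpow_add hy.1, ← Real.rpow_natCast,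
    Nat.cast_sub hn, Nat.cast_one]

theorem setIntegral_ball_norm_rpow {n : ℕ} (p : ℝ) {r : ℝ} (hr : 0 < r) :
    ∫ ξ in Metric.ball (0 : Ell n) r, ‖ξ‖ ^ p =
      r ^ ((n : ℝ) + p) * ∫ ξ in Metric.ball (0 : Ell n) 1, ‖ξ‖ ^ p := by
  have h := Measure.setIntegral_comp_smul_of_pos volume (fun ξ : Ell n => ‖ξ‖ ^ p)
    (Metric.ball 0 1) hr
  rw [smul_unitBall_of_pos hr, finrank_euclideanSpace_fin, smul_eq_mul] at h
  have h2 : ∀ ξ : Ell n, ‖r • ξ‖ ^ p = r ^ p * ‖ξ‖ ^ p := fun ξ => by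
    rw [norm_smul, Real.norm_of_nonneg hr.le, Real.mul_rpow hr.le (norm_nonneg _)]
  simp_rw [h2] at h
  rw [integral_const_mul] at h
  rw [Real.rpow_add hr, Real.rpow_natCast, mul_assoc, h, mul_inv_cancel_left₀ (by positivity)]

theorem integrable_norm_rpow_mul_sq {n : ℕ} {s : ℝ} (hs : 0 ≤ s) (F : 𝓢(Ell n, ℂ)) :
    Integrable fun ξ => ‖ξ‖ ^ (2 * s) * ‖F ξ‖ ^ 2 := by
  have hc : Continuous fun ξ : Ell n => ‖ξ‖ ^ (2 * s) :=
    continuous_norm.rpow_const fun _ => .inr (by positivity)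
  have hF := F.continuous
  obtain ⟨N, hN⟩ := exists_nat_ge (2 * s)
  set C := SchwartzMap.seminorm ℝ 0 0 F
  have hC : ∀ ξ, ‖F ξ‖ ≤ C := fun ξ => norm_le_seminorm ℝ F ξ
  have h0 := F.integrable_pow_mul volume 0
  have h1 := F.integrable_pow_mul volume N
  refine ((h0.add h1).const_mul C).mono' (by fun_prop) (ae_of_all _ fun ξ => ?_)
  rw [Real.norm_of_nonneg (by positivity)]
  have h2 : ‖ξ‖ ^ (2 * s) ≤ 1 + ‖ξ‖ ^ N := by
    rcases le_total ‖ξ‖ 1 with h | h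
    · have := Real.rpow_le_one (norm_nonneg ξ) h (show 0 ≤ 2 * s by positivity)
      linarith [pow_nonneg (norm_nonneg ξ) N]
    · have := Real.rpow_le_rpow_of_exponent_le h hN
      rw [Real.rpow_natCast] at this
      linarith
  calc ‖ξ‖ ^ (2 * s) * ‖F ξ‖ ^ 2 = ‖ξ‖ ^ (2 * s) * ‖F ξ‖ * ‖F ξ‖ := by ring
    _ ≤ (1 + ‖ξ‖ ^ N) * ‖F ξ‖ * C := by
        gcongr
        exact hC ξ
    _ = C * (‖ξ‖ ^ 0 * ‖F ξ‖ + ‖ξ‖ ^ N * ‖F ξ‖) := by ring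

/-- Cauchy–Schwarz bound of `‖∇w‖_∞` for `w` with spectrum in a ball of radius `r`. -/
theorem integral_norm_mul_sq_le {n : ℕ} (hn : 1 ≤ n) {s₁ : ℝ} (hs₁ : 0 ≤ s₁)
    (hs₁' : s₁ < (n : ℝ) / 2 + 1) {r : ℝ} (hr : 0 < r) (b F : 𝓢(Ell n, ℂ))
    (hbF : ∀ ξ, ‖b ξ‖ ≤ ‖F ξ‖) (hb : ∀ ξ, b ξ ≠ 0 → ‖ξ‖ < r) :
    (∫ ξ, ‖ξ‖ * ‖b ξ‖) ^ 2 ≤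
      r ^ ((n : ℝ) + 2 * (1 - s₁)) * (∫ ξ in Metric.ball (0 : Ell n) 1, ‖ξ‖ ^ (2 * (1 - s₁))) *
        ∫ ξ, ‖ξ‖ ^ (2 * s₁) * ‖F ξ‖ ^ 2 := by
  have hF := F.continuous
  have hc : Continuous fun ξ : Ell n => ‖ξ‖ ^ s₁ := continuous_norm.rpow_const fun _ => .inr hs₁
  have hsq : ∀ (q : ℝ) (ξ : Ell n), (‖ξ‖ ^ q) ^ 2 = ‖ξ‖ ^ (2 * q) := fun q ξ => by
    rw [mul_comm, Real.rpow_mul (norm_nonneg _), Real.rpow_two]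
  have hI := integrable_norm_rpow_mul_sq hs₁ F
  have hm1 : MemLp (fun ξ : Ell n => ‖ξ‖ ^ (1 - s₁)) 2 (volume.restrict (Metric.ball 0 r)) := by
    rw [memLp_two_iff_integrable_sq (measurable_norm.pow_const _).aestronglyMeasurable]
    simp_rw [hsq]
    exact integrableOn_ball_norm_rpow hn (by linarith) r
  have hm2 : MemLp (fun ξ : Ell n => ‖ξ‖ ^ s₁ * ‖F ξ‖) 2 (volume.restrict (Metric.ball 0 r)) := by
    rw [memLp_two_iff_integrable_sq (by fun_prop)]
    simp_rw [mul_pow, hsq]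
    exact hI.integrableOn
  have h1 : ∫ ξ, ‖ξ‖ * ‖b ξ‖ ≤ ∫ ξ in Metric.ball (0 : Ell n) r,
      ‖ξ‖ ^ (1 - s₁) * (‖ξ‖ ^ s₁ * ‖F ξ‖) := by
    rw [← setIntegral_eq_integral_of_forall_compl_eq_zero (s := Metric.ball (0 : Ell n) r)]
    · refine integral_mono_of_nonneg (ae_of_all _ fun ξ => by positivity)
        (hm1.integrable_mul hm2) (ae_of_all _ fun ξ => ?_)
      dsimp only
      rcases eq_or_ne ξ 0 with rfl | hξ
      · rw [norm_zero, zero_mul]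
        positivity
      · rw [← mul_assoc, ← Real.rpow_add (norm_pos_iff.2 hξ), sub_add_cancel, Real.rpow_one]
        gcongr
        exact hbF ξ
    · intro ξ hξ
      have : b ξ = 0 := by
        by_contra h0
        exact hξ (by simpa using hb ξ h0)
      rw [this, norm_zero, mul_zero]
  have h2 := integral_mul_le_Lp_mul_Lq_of_nonneg Real.HolderConjugate.two_two
    (ae_of_all _ fun ξ : Ell n => (by positivity : (0 : ℝ) ≤ ‖ξ‖ ^ (1 - s₁)))
    (ae_of_all _ fun ξ : Ell n => (by positivity : (0 : ℝ) ≤ ‖ξ‖ ^ s₁ * ‖F ξ‖))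
    (by simpa using hm1) (by simpa using hm2)
  simp_rw [Real.rpow_two, mul_pow, hsq, ← Real.sqrt_eq_rpow] at h2
  have h0 : 0 ≤ ∫ ξ, ‖ξ‖ * ‖b ξ‖ := integral_nonneg fun ξ => by positivity
  calc (∫ ξ, ‖ξ‖ * ‖b ξ‖) ^ 2 ≤ _ := pow_le_pow_left₀ h0 (h1.trans h2) 2
    _ = (∫ ξ in Metric.ball (0 : Ell n) r, ‖ξ‖ ^ (2 * (1 - s₁))) *
        ∫ ξ in Metric.ball (0 : Ell n) r, ‖ξ‖ ^ (2 * s₁) * ‖F ξ‖ ^ 2 := by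
      rw [mul_pow, Real.sq_sqrt (integral_nonneg fun ξ => by positivity),
        Real.sq_sqrt (integral_nonneg fun ξ => by positivity)]
    _ ≤ (∫ ξ in Metric.ball (0 : Ell n) r, ‖ξ‖ ^ (2 * (1 - s₁))) *
        ∫ ξ, ‖ξ‖ ^ (2 * s₁) * ‖F ξ‖ ^ 2 := by
      refine mul_le_mul_of_nonneg_left ?_ (integral_nonneg fun ξ => by positivity)
      exact setIntegral_le_integral hI (ae_of_all _ fun ξ => by positivity)
    _ = _ := by rw [setIntegral_ball_norm_rpow _ hr]

/-- Almost orthogonality of the dyadic blocks in `Ḣ^{s₂}`. -/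
theorem sum_dyadic_sq_le {n : ℕ} (hn : 1 ≤ n) {φ : Ell n → ℝ} (hφ : LPFunction φ) {s₂ : ℝ}
    (hs₂ : 0 ≤ s₂) (F : 𝓢(Ell n, ℂ)) {a : ℤ → 𝓢(Ell n, ℂ)}
    (ha : ∀ i ξ, a i ξ = (φ ((2 : ℝ) ^ (-i) • ξ) : ℂ) * F ξ) (T : Finset ℤ) :
    ∑ i ∈ T, ((2 : ℝ) ^ i) ^ (2 * s₂) * ∫ ξ, ‖a i ξ‖ ^ 2 ≤
      (4 / 3) ^ (2 * s₂) * ∫ ξ, ‖ξ‖ ^ (2 * s₂) * ‖F ξ‖ ^ 2 := by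
  have : NeZero n := ⟨by omega⟩
  have hne : ∀ᵐ ξ : Ell n, ξ ≠ 0 := by
    simp [ae_iff]
  simp_rw [← integral_const_mul]
  rw [← integral_finsetSum _ fun i _ => (integrable_norm_sq (a i)).const_mul _]
  refine integral_mono_ae (integrable_finsetSum _ fun i _ => (integrable_norm_sq (a i)).const_mul _)
    ((integrable_norm_rpow_mul_sq hs₂ F).const_mul _) ?_
  filter_upwards [hne] with ξ hξ
  have hterm : ∀ i ∈ T, ((2 : ℝ) ^ i) ^ (2 * s₂) * ‖a i ξ‖ ^ 2 ≤
      φ ((2 : ℝ) ^ (-i) • ξ) * ((4 / 3) ^ (2 * s₂) * (‖ξ‖ ^ (2 * s₂) * ‖F ξ‖ ^ 2)) := by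
    intro i _
    obtain ⟨h0, h1⟩ := hφ.2.2.2.1 ((2 : ℝ) ^ (-i) • ξ)
    rw [ha, norm_mul, Complex.norm_real, Real.norm_of_nonneg h0]
    set t := φ ((2 : ℝ) ^ (-i) • ξ) with ht
    rcases eq_or_ne t 0 with h | h
    · simp [h]
    have h3 := (hφ.2.2.1 _ h).1
    rw [norm_two_zpow_smul, zpow_neg, inv_mul_eq_div, le_div_iff₀ (by positivity)] at h3
    have h4 : (2 : ℝ) ^ i ≤ 4 / 3 * ‖ξ‖ := by linarith
    have h5 : ((2 : ℝ) ^ i) ^ (2 * s₂) ≤ (4 / 3) ^ (2 * s₂) * ‖ξ‖ ^ (2 * s₂) := by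
      rw [← Real.mul_rpow (by norm_num) (norm_nonneg _)]
      gcongr
    calc _ = t * t * (((2 : ℝ) ^ i) ^ (2 * s₂) * ‖F ξ‖ ^ 2) := by ring
      _ ≤ t * 1 * (((4 / 3) ^ (2 * s₂) * ‖ξ‖ ^ (2 * s₂)) * ‖F ξ‖ ^ 2) := by gcongr
      _ = _ := by ring
  refine (Finset.sum_le_sum hterm).trans ?_
  rw [← Finset.sum_mul]
  refine mul_le_of_le_one_left (by positivity) ?_
  exact sum_le_hasSum T (fun i _ => (hφ.2.2.2.1 _).1) (hφ.hasSum hξ)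

/-- **High–low commutator piece.** Under the conditions `s ≥ 1`,
`1 ≤ s₁ < n/2 + 1`, `s₂ > 0`, `s₁ + s₂ = s + n/2 + 1`, one has
`Σ_i ‖Λ^s[(Δ_i u·∇)(Ṡ_{i−9}B)] − (Δ_i u·∇)(Λ^s Ṡ_{i−9}B)‖²_{L²}
≤ c ‖u‖²_{Ḣ^{s₂}} ‖B‖²_{Ḣ^{s₁}}`. -/
theorem commutator_piece_highlow (n : ℕ) (hn : 1 ≤ n)
    (φ : Ell n → ℝ) (hφ : LPFunction φ) (s s₁ s₂ : ℝ)
    (hs : 1 ≤ s) (hs₂ : 0 < s₂) (hs₁ : 1 ≤ s₁) (hs₁' : s₁ < (n : ℝ) / 2 + 1)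
    (hsum : s₁ + s₂ = s + (n : ℝ) / 2 + 1) :
    ∃ c > (0 : ℝ), ∀ u B : Fin n → 𝓢(Ell n, ℝ),
      (∑' i : ℤ, ∑ l, ∫ x, ‖Lam s (adv (fun i' => DeltaJ φ i (cf (u i')))
            (fun l' => SJ φ (i - 9) (cf (B l'))) l) x
          - adv (fun i' => DeltaJ φ i (cf (u i')))
            (fun l' => Lam s (SJ φ (i - 9) (cf (B l')))) l x‖ ^ 2)
        ≤ c * Hnorm s₂ (fun l x => u l x) ^ 2 * Hnorm s₁ (fun l x => B l x) ^ 2 := by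
  set D := 2 * (((4 : ℝ) ^ s) ^ 2 + 1) * (n * (2 * Real.pi) ^ 2) with hD
  set I := ∫ ξ in Metric.ball (0 : Ell n) 1, ‖ξ‖ ^ (2 * (1 - s₁)) with hI
  have hI0 : 0 ≤ I := integral_nonneg fun ξ => by positivity
  have hD0 : 0 ≤ D := by positivity
  refine ⟨D * I * (4 / 3) ^ (2 * s₂) + 1, by positivity, fun u B => ?_⟩
  choose a ha using fun (i : ℤ) (k : Fin n) =>
    exists_schwartz_dilate_mul hφ.1 hφ.2.1 i (𝓕 (toComplex (u k)))
  choose b hb using fun (i : ℤ) (l : Fin n) =>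
    exists_schwartz_dilate_mul hφ.contDiff_lowCut
      (hasCompactSupport_of_norm_le fun ξ hξ => hφ.lowCut_eq_zero hξ) (i - 9) (𝓕 (toComplex (B l)))
  have hH0 : ∀ (σ : ℝ) (f : Fin n → 𝓢(Ell n, ℝ)), 0 ≤ ∑ l, HsqC σ (cf (f l)) := fun σ f =>
    Finset.sum_nonneg fun l _ => integral_nonneg fun ξ => by positivity
  have hH : ∀ (σ : ℝ) (f : Fin n → 𝓢(Ell n, ℝ)), Hnorm σ (fun l x => f l x) ^ 2 =
      ∑ l, ∫ ξ, ‖ξ‖ ^ (2 * σ) * ‖𝓕 (toComplex (f l)) ξ‖ ^ 2 := fun σ f => by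
    rw [Hnorm, Real.sq_sqrt (hH0 σ f)]
    rfl
  set U := Hnorm s₂ (fun l x => u l x) ^ 2 with hU
  set V := Hnorm s₁ (fun l x => B l x) ^ 2 with hV
  have hU0 : 0 ≤ U := sq_nonneg _
  have hV0 : 0 ≤ V := sq_nonneg _
  have hterm : ∀ i : ℤ, (∑ l, ∫ x, ‖Lam s (adv (fun i' => DeltaJ φ i (cf (u i')))
            (fun l' => SJ φ (i - 9) (cf (B l'))) l) x
          - adv (fun i' => DeltaJ φ i (cf (u i')))
            (fun l' => Lam s (SJ φ (i - 9) (cf (B l')))) l x‖ ^ 2) ≤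
      D * I * V * ∑ k, ((2 : ℝ) ^ i) ^ (2 * s₂) * ∫ ξ, ‖a i k ξ‖ ^ 2 := by
    intro i
    have h2i : (0 : ℝ) < 2 ^ i := by positivity
    have hbs : ∀ l ξ, b i l ξ ≠ 0 → ‖ξ‖ ≤ (2 : ℝ) ^ i / 4 := fun l ξ h => by
      rw [hb] at h
      have h1 : ¬ 4 / 3 < ‖(2 : ℝ) ^ (-(i - 9)) • ξ‖ := fun h2 => h (by
        rw [hφ.lowCut_eq_zero h2, Complex.ofReal_zero, zero_mul])
      rw [norm_two_zpow_smul, not_lt, neg_sub, zpow_sub₀ two_ne_zero, div_mul_eq_mul_div,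
        div_le_iff₀ h2i] at h1
      norm_num at h1
      linarith
    have has : ∀ k ξ, a i k ξ ≠ 0 → 3 / 4 * (2 : ℝ) ^ i ≤ ‖ξ‖ ∧ ‖ξ‖ ≤ 8 / 3 * (2 : ℝ) ^ i :=
      fun k ξ h => by
        have h1 : φ ((2 : ℝ) ^ (-i) • ξ) ≠ 0 := fun h2 => h (by
          rw [ha, h2, Complex.ofReal_zero, zero_mul])
        have h2 := hφ.2.2.1 _ h1
        rw [norm_two_zpow_smul, zpow_neg, inv_mul_eq_div, le_div_iff₀ h2i, div_le_iff₀ h2i] at h2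
        exact h2
    have hbF : ∀ l ξ, ‖b i l ξ‖ ≤ ‖𝓕 (toComplex (B l)) ξ‖ := fun l ξ => by
      obtain ⟨h0, h1⟩ := hφ.lowCut_mem_Icc ((2 : ℝ) ^ (-(i - 9)) • ξ)
      rw [hb, norm_mul, Complex.norm_real, Real.norm_of_nonneg h0]
      exact mul_le_of_le_one_left (norm_nonneg _) h1
    have hexp : (((2 : ℝ) ^ i) ^ s) ^ 2 * ((2 : ℝ) ^ i) ^ ((n : ℝ) + 2 * (1 - s₁)) =
        ((2 : ℝ) ^ i) ^ (2 * s₂) := by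
      rw [← Real.rpow_two, ← Real.rpow_mul h2i.le, ← Real.rpow_add h2i]
      congr 1
      linarith
    simp_rw [adv, fun k => deltaJ_eq i (u k) (ha i k), fun l => sJ_eq hn hφ (i - 9) (B l) (hb i l)]
    rw [hV, hH, ← Finset.mul_sum, Finset.mul_sum (a := D * I), Finset.sum_mul]
    refine Finset.sum_le_sum fun l _ => ?_
    refine (commutator_sq_integral_le (by linarith) (a i) (b i l) h2i has (hbs l)).trans ?_
    have hM := integral_norm_mul_sq_le hn (by linarith) hs₁' h2i (b i l) (𝓕 (toComplex (B l)))
      (hbF l) fun ξ h => (hbs l ξ h).trans_lt (by linarith)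
    have hA : 0 ≤ ∑ k, ∫ ξ, ‖a i k ξ‖ ^ 2 :=
      Finset.sum_nonneg fun k _ => integral_nonneg fun ξ => by positivity
    rw [← hD, ← hexp]
    calc _ ≤ D * (((2 : ℝ) ^ i) ^ s) ^ 2 * _ * ∑ k, ∫ ξ, ‖a i k ξ‖ ^ 2 :=
          mul_le_mul_of_nonneg_right (mul_le_mul_of_nonneg_left hM (by positivity)) hA
      _ = _ := by ring
  refine Real.tsum_le_of_sum_le
    (fun i => Finset.sum_nonneg fun l _ => integral_nonneg fun x => by positivity) fun T => ?_
  calc _ ≤ ∑ i ∈ T, D * I * V * ∑ k, ((2 : ℝ) ^ i) ^ (2 * s₂) * ∫ ξ, ‖a i k ξ‖ ^ 2 :=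
        Finset.sum_le_sum fun i _ => hterm i
    _ = D * I * V * ∑ k, ∑ i ∈ T, ((2 : ℝ) ^ i) ^ (2 * s₂) * ∫ ξ, ‖a i k ξ‖ ^ 2 := by
        rw [← Finset.mul_sum, Finset.sum_comm]
    _ ≤ D * I * V * ((4 / 3) ^ (2 * s₂) * U) := by
        refine mul_le_mul_of_nonneg_left ?_ (by positivity)
        rw [hU, hH, Finset.mul_sum]
        exact Finset.sum_le_sum fun k _ => sum_dyadic_sq_le hn hφ hs₂.le _ (fun i => ha i k) T
    _ ≤ _ := by nlinarith [mul_nonneg hU0 hV0]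

end
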